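/- Let β > 0 and k < 0 be real numbers, and let Q⁺⁺(k) = {(x,y,z) ∈ ℝ³ : β(x²y²+y²z²+z²x²) + (x²+y²+z²+1/2)² − (1−k)/4 = 0}. Then Q⁺⁺(k) is a nonempty compact connected set homeomorphic to the 2-sphere. -/

import Mathlib

/-- A set avoiding the origin that meets every ray in exactly one point, at a continuously
varying distance, is homeomorphic to the unit sphere. -/
noncomputable def radialHomeomorphSphere {E : Type*} [NormedAddCommGroup E] [NormedSpace ℝ E]
    (Q : Set E) (r : E → ℝ) (hr : Continuous r) (hpos : ∀ s, 0 < r s) (h0 : (0 : E) ∉ Q)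
    (h : ∀ s : E, ‖s‖ = 1 → ∀ t : ℝ, 0 < t → (t • s ∈ Q ↔ t = r s)) :
    Q ≃ₜ Metric.sphere (0 : E) 1 where
  toFun p := ⟨‖(p : E)‖⁻¹ • (p : E), by
    have hp : (p : E) ≠ 0 := fun hp => h0 (hp ▸ p.2)
    simp [norm_smul, hp]⟩
  invFun s := ⟨r s • (s : E), (h s (by simp) _ (hpos s)).2 rfl⟩
  left_inv p := by
    have hp : (p : E) ≠ 0 := fun hp => h0 (hp ▸ p.2)
    have hn : ‖(p : E)‖ ≠ 0 := norm_ne_zero_iff.2 hp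
    have key := (h (‖(p : E)‖⁻¹ • (p : E)) (by simp [norm_smul, hp]) ‖(p : E)‖
      (norm_pos_iff.2 hp)).1 (by simp [smul_smul, hn])
    ext1
    change r (‖(p : E)‖⁻¹ • (p : E)) • ‖(p : E)‖⁻¹ • (p : E) = p
    rw [← key, smul_smul, mul_inv_cancel₀ hn, one_smul]
  right_inv s := by
    ext1
    change ‖r s • (s : E)‖⁻¹ • r s • (s : E) = s
    rw [norm_smul, norm_eq_of_mem_sphere s, Real.norm_of_nonneg (hpos s).le, mul_one, smul_smul,
      inv_mul_cancel₀ (hpos s).ne', one_smul]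
  continuous_toFun := by
    refine Continuous.subtype_mk (Continuous.smul (Continuous.inv₀ (by fun_prop) ?_)
      continuous_subtype_val) _
    exact fun p => norm_ne_zero_iff.2 fun hp => h0 (hp ▸ p.2)
  continuous_invFun := by
    refine Continuous.subtype_mk ?_ _
    fun_prop

/-- The positive root in `t` of the biquadratic equation `a * t ^ 4 + t ^ 2 + k / 4 = 0`. -/
lemma biquadratic_root_iff {a k t : ℝ} (ha : 0 < a) (hk : k < 0) (ht : 0 < t) :
    a * t ^ 4 + t ^ 2 + k / 4 = 0 ↔ t = √((√(1 - k * a) - 1) / (2 * a)) := by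
  have hka : k * a < 0 := mul_neg_of_neg_of_pos hk ha
  rw [eq_comm (a := t), Real.sqrt_eq_iff_eq_sq (div_nonneg (sub_nonneg.2
    (Real.one_le_sqrt.2 (by linarith))) (by positivity)) ht.le,
    div_eq_iff (by positivity), sub_eq_iff_eq_add,
    Real.sqrt_eq_iff_eq_sq (by linarith) (by positivity)]
  constructor
  · intro h
    linear_combination -4 * a * h
  · intro h
    have : a * (a * t ^ 4 + t ^ 2 + k / 4) = 0 := by linear_combination -h / 4
    exact (mul_eq_zero.1 this).resolve_left ha.ne'

/-- for `β > 0`, `k < 0`, the quartic `Q⁺⁺(k)`, the zero set of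
`β·v + (u + 1/2)² - (1-k)/4`, is a nonempty compact connected set homeomorphic
to the 2-sphere. -/
theorem stmt_8 (β k : ℝ) (hβ : 0 < β) (hk : k < 0)
    (Q : Set (EuclideanSpace ℝ (Fin 3)))
    (hQ : Q = {p | β * ((p 0)^2*(p 1)^2 + (p 1)^2*(p 2)^2 + (p 2)^2*(p 0)^2)
        + ((p 0)^2 + (p 1)^2 + (p 2)^2 + 1/2)^2 - (1 - k)/4 = 0}) :
    Q.Nonempty ∧ IsCompact Q ∧ IsConnected Q ∧
      Nonempty (↥Q ≃ₜ ↥(Metric.sphere (0 : EuclideanSpace ℝ (Fin 3)) 1)) := by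
  let a : EuclideanSpace ℝ (Fin 3) → ℝ := fun p =>
    1 + β * ((p 0)^2*(p 1)^2 + (p 1)^2*(p 2)^2 + (p 2)^2*(p 0)^2)
  have ha : ∀ p, 0 < a p := fun p => by positivity
  have hac : Continuous a := by fun_prop
  let e : Q ≃ₜ Metric.sphere (0 : EuclideanSpace ℝ (Fin 3)) 1 :=
    radialHomeomorphSphere Q (fun p => √((√(1 - k * a p) - 1) / (2 * a p)))
      (Real.continuous_sqrt.comp (Continuous.div (by fun_prop) (by fun_prop)
        fun p => (mul_pos two_pos (ha p)).ne'))
      (fun p => by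
        have hka : k * a p < 0 := mul_neg_of_neg_of_pos hk (ha p)
        exact Real.sqrt_pos.2 (div_pos (sub_pos.2 (Real.lt_sqrt_of_sq_lt (by linarith)))
          (by linarith [ha p])))
      (by
        rw [hQ]
        intro h
        norm_num at h
        linarith)
      (by
        intro s hs t ht
        rw [← biquadratic_root_iff (ha s) hk ht, hQ]
        have hs2 : (s 0)^2 + (s 1)^2 + (s 2)^2 = 1 := by
          have := EuclideanSpace.real_norm_sq_eq s
          rw [hs, Fin.sum_univ_three] at this
          linarith
        simp only [Set.mem_ofPred_eq, PiLp.smul_apply, smul_eq_mul, a]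
        have hu : (t * s 0)^2 + (t * s 1)^2 + (t * s 2)^2 = t ^ 2 := by
          linear_combination t ^ 2 * hs2
        rw [hu]
        ring_nf)
  have hsphere : IsConnected (Metric.sphere (0 : EuclideanSpace ℝ (Fin 3)) 1) :=
    isConnected_sphere (by
      rw [← Module.finrank_eq_rank, finrank_euclideanSpace_fin]
      norm_num) 0 zero_le_one
  have hQc : IsConnected Q := by
    rw [isConnected_iff_connectedSpace] at hsphere ⊢
    exact e.symm.surjective.connectedSpace e.symm.continuous
  have hQk : IsCompact Q := by
    rw [isCompact_iff_compactSpace]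
    exact e.symm.compactSpace
  exact ⟨hQc.nonempty, hQk, hQc, ⟨e⟩⟩
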